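/- Lax distributivity holds up to a compatible allegorical equivalence: let C have binary products and chosen pullbacks and let ∼ be an equivalence relation on spans of C that relates any two vertically isomorphic spans and is inv-compatible, comp-compatible, meet-compatible, and allegorical. Then for all spans (f,g),(p,q) : A ⇸ B and (h,k) : B ⇸ C one has ((h,k)∘((f,g)∧(p,q))) ∧ (((h,k)∘(f,g))∧((h,k)∘(p,q))) ∼ (h,k)∘((f,g)∧(p,q)), where all composites and meets are computed via the chosen pullbacks and products. -/

import Mathlib

open CategoryTheory CategoryTheory.Limits

universe v u

/-- A span `(f,g) : A ⇸ B` in `C`: an apex `D` with `f : D ⟶ A` and `g : D ⟶ B`. -/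
structure MySpan (C : Type u) [Category.{v} C] (A B : C) where
  apex : C
  left : apex ⟶ A
  right : apex ⟶ B

namespace MySpan

variable {C : Type u} [Category.{v} C]

/-- The involution `(f,g)° = (g,f)`. -/
def symm {A B : C} (S : MySpan C A B) : MySpan C B A :=
  ⟨S.apex, S.right, S.left⟩

/-- The horizontal composite `(h,k)∘(f,g)` of `S = (f,g) : A ⇸ B` with `T = (h,k) : B ⇸ X`,
computed via the chosen pullback of `g` and `h`. -/
noncomputable def comp [HasPullbacks C] {A B X : C} (S : MySpan C A B) (T : MySpan C B X) :
    MySpan C A X :=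
  ⟨pullback S.right T.left, pullback.fst S.right T.left ≫ S.left,
    pullback.snd S.right T.left ≫ T.right⟩

/-- The meet `(f,g)∧(p,q)` of two parallel spans, computed via the chosen pullback of
`⟨f,g⟩` and `⟨p,q⟩`. -/
noncomputable def meet [HasPullbacks C] [HasBinaryProducts C] {A B : C}
    (S T : MySpan C A B) : MySpan C A B :=
  ⟨pullback (prod.lift S.left S.right) (prod.lift T.left T.right),
    pullback.fst (prod.lift S.left S.right) (prod.lift T.left T.right) ≫ S.left,
    pullback.fst (prod.lift S.left S.right) (prod.lift T.left T.right) ≫ S.right⟩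

end MySpan

variable {C : Type u} [Category.{v} C]

/-- `S ≤_E T` : there is a morphism of spans `x : S → T` lying in `E`. -/
def SpanLe (E : MorphismProperty C) {A B : C} (S T : MySpan C A B) : Prop :=
  ∃ x : S.apex ⟶ T.apex, E x ∧ x ≫ T.left = S.left ∧ x ≫ T.right = S.right

/-- `∼_E` : the least equivalence relation on spans `A ⇸ B` containing `≤_E`. -/
def SpanSim (E : MorphismProperty C) {A B : C} : MySpan C A B → MySpan C A B → Prop :=
  Relation.EqvGen (SpanLe E)

/-- A stable system: a class of morphisms containing all isomorphisms, closed under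
composition, and stable under pullback. -/
structure IsStableSystem (E : MorphismProperty C) : Prop where
  of_isIso : ∀ {X Y : C} (f : X ⟶ Y), IsIso f → E f
  comp_mem : ∀ {X Y Z : C} (f : X ⟶ Y) (g : Y ⟶ Z), E f → E g → E (f ≫ g)
  pullback_stable : ∀ {P X Y Z : C} (fst : P ⟶ X) (snd : P ⟶ Y) (f : X ⟶ Z) (g : Y ⟶ Z),
    IsPullback fst snd f g → E g → E fst

/-- `∼_E` is allegorical: `(1_A, f) ∼_E (p₁, f∘p₂)` with `(p₁,p₂)` the kernel pair of `f`,
i.e. `(1_A,f) ∼_E (f,f)∘(1_A,f)`. -/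
def SimAllegorical [HasPullbacks C] (E : MorphismProperty C) : Prop :=
  ∀ {A B : C} (f : A ⟶ B),
    SpanSim E (⟨A, 𝟙 A, f⟩ : MySpan C A B)
      ⟨pullback f f, pullback.fst f f, pullback.snd f f ≫ f⟩

section SpanRelation

variable [HasPullbacks C] [HasBinaryProducts C]
variable (r : ∀ ⦃A B : C⦄, MySpan C A B → MySpan C A B → Prop)

/-- `r` relates any two vertically isomorphic spans. -/
def RelatesVertIso : Prop :=
  ∀ {A B : C} (S T : MySpan C A B) (u : S.apex ⟶ T.apex),
    IsIso u → u ≫ T.left = S.left → u ≫ T.right = S.right → r S T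

/-- `r` is inv-compatible: `(f,g) ∼ (f',g')` implies `(g,f) ∼ (g',f')`. -/
def InvCompatible : Prop :=
  ∀ {A B : C} (S T : MySpan C A B), r S T → r S.symm T.symm

/-- `r` is comp-compatible: `(f,g) ∼ (f',g')` implies `(h,k)∘(f,g) ∼ (h,k)∘(f',g')`. -/
def CompCompatible : Prop :=
  ∀ {A B X : C} (S T : MySpan C A B) (U : MySpan C B X), r S T → r (S.comp U) (T.comp U)

/-- `r` is meet-compatible: `(f,g) ∼ (f',g')` implies `(f,⟨f,g⟩) ∼ (f',⟨f',g'⟩)`. -/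
def MeetCompatible : Prop :=
  ∀ {A B : C} (S T : MySpan C A B), r S T →
    r (⟨S.apex, S.left, prod.lift S.left S.right⟩ : MySpan C A (A ⨯ B))
      ⟨T.apex, T.left, prod.lift T.left T.right⟩

/-- `r` is allegorical: `(1_A,f) ∼ (f,f)∘(1_A,f)` for every morphism `f : A ⟶ B`. -/
def RelAllegorical : Prop :=
  ∀ {A B : C} (f : A ⟶ B),
    r (⟨A, 𝟙 A, f⟩ : MySpan C A B)
      (MySpan.comp (⟨A, 𝟙 A, f⟩ : MySpan C A B) (⟨A, f, f⟩ : MySpan C B B))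

end SpanRelation

section SplitEpi

variable [HasPullbacks C]
variable {r : ∀ ⦃A B : C⦄, MySpan C A B → MySpan C A B → Prop}

/-- The horizontal composite may be computed by any pullback. -/
theorem RelatesVertIso.comp_of_isPullback (hiso : RelatesVertIso r) {A B X : C}
    (S : MySpan C A B) (T : MySpan C B X) {P : C} {p : P ⟶ S.apex} {q : P ⟶ T.apex}
    (h : IsPullback p q S.right T.left) :
    r (⟨P, p ≫ S.left, q ≫ T.right⟩ : MySpan C A X) (S.comp T) :=
  hiso _ _ h.isoPullback.hom (Iso.isIso_hom h.isoPullback)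
    (h.isoPullback_hom_fst_assoc S.left) (h.isoPullback_hom_snd_assoc T.right)

/-- If `s` is a section of `e`, pulling `s` back along the first projection of the kernel pair
of `e` gives the domain of `e`. -/
theorem isPullback_kernelPair_section {P W : C} (e : P ⟶ W) (s : W ⟶ P) (hs : s ≫ e = 𝟙 W) :
    IsPullback (pullback.lift (f := e) (g := e) (e ≫ s) (𝟙 P) (by simp [hs])) e
      (pullback.fst e e ≫ 𝟙 P) s := by
  refine ⟨⟨by simp [pullback.lift_fst]⟩, ⟨PullbackCone.IsLimit.mk _
    (fun c => c.fst ≫ pullback.snd e e) (fun c => ?_) (fun c => ?_) (fun c m hm _ => ?_)⟩⟩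
  all_goals
    have he : c.fst ≫ pullback.snd e e ≫ e = c.snd := by
      have hc := c.condition =≫ e
      simpa [hs, pullback.condition] using hc
  · apply pullback.hom_ext
    · have hc := c.condition
      simpa [pullback.lift_fst, reassoc_of% he] using hc.symm
    · simp [pullback.lift_snd]
  · simpa using he
  · simp [← hm, pullback.lift_snd]

/-- Precomposing both legs of a span with a split epimorphism gives a related span. -/
theorem rel_precomp_split_epi
    (hequiv : ∀ A B : C, Equivalence (fun S T : MySpan C A B => r S T))
    (hiso : RelatesVertIso r) (hinv : InvCompatible r) (hcomp : CompCompatible r)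
    (hall : RelAllegorical r) {A B : C} (S : MySpan C A B) {P : C} (e : P ⟶ S.apex)
    (s : S.apex ⟶ P) (hs : s ≫ e = 𝟙 _) :
    r (⟨P, e ≫ S.left, e ≫ S.right⟩ : MySpan C A B) S := by
  have h := hcomp _ _ (⟨S.apex, s, S.left⟩ : MySpan C P A) (hinv _ _ (hall e))
  have h₁ := hiso.comp_of_isPullback (⟨P, e, 𝟙 P⟩ : MySpan C S.apex P)
    (⟨S.apex, s, S.left⟩ : MySpan C P A) (IsPullback.of_id_snd (f := s))
  have h₂ := hiso.comp_of_isPullback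
    (((⟨P, 𝟙 P, e⟩ : MySpan C P S.apex).comp ⟨P, e, e⟩).symm)
    (⟨S.apex, s, S.left⟩ : MySpan C P A) (isPullback_kernelPair_section e s hs)
  have hl : r (⟨S.apex, 𝟙 _, S.left⟩ : MySpan C S.apex A) ⟨P, e, e ≫ S.left⟩ := by
    have h₃ := (hequiv _ _).trans h₁ ((hequiv _ _).trans h ((hequiv _ _).symm h₂))
    convert h₃ using 2
    · exact hs.symm
    · exact (Category.id_comp _).symm
    · exact ((pullback.lift_snd_assoc _ _ _ _).trans (Category.id_comp _)).symm
  have h₄ := hcomp _ _ (⟨S.apex, 𝟙 _, S.right⟩ : MySpan C S.apex B) (hinv _ _ hl)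
  have h₅ := hiso.comp_of_isPullback (⟨P, e ≫ S.left, e⟩ : MySpan C A S.apex)
    (⟨S.apex, 𝟙 _, S.right⟩ : MySpan C S.apex B) (IsPullback.of_id_fst (f := e))
  have h₆ := hiso.comp_of_isPullback (⟨S.apex, S.left, 𝟙 _⟩ : MySpan C A S.apex)
    (⟨S.apex, 𝟙 _, S.right⟩ : MySpan C S.apex B) (IsPullback.of_id_fst (f := 𝟙 _))
  simpa only [Category.id_comp] using
    (hequiv _ _).trans h₅ ((hequiv _ _).trans ((hequiv _ _).symm h₄) ((hequiv _ _).symm h₆))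

/-- If `S` factors through `T` as a span, then the meet of `S` and `T` is related to `S`. -/
theorem rel_meet_of_factors [HasBinaryProducts C]
    (hequiv : ∀ A B : C, Equivalence (fun S T : MySpan C A B => r S T))
    (hiso : RelatesVertIso r) (hinv : InvCompatible r) (hcomp : CompCompatible r)
    (hall : RelAllegorical r) {A B : C} (S T : MySpan C A B) (m : S.apex ⟶ T.apex)
    (hl : m ≫ T.left = S.left) (hr : m ≫ T.right = S.right) : r (S.meet T) S :=
  rel_precomp_split_epi hequiv hiso hinv hcomp hall S (pullback.fst _ _)
    (pullback.lift (𝟙 _) m (by rw [Category.id_comp, prod.comp_lift, hl, hr]))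
    (pullback.lift_fst _ _ _)

end SplitEpi

namespace MySpan

variable [HasPullbacks C]

/-- A span that factors through both `S` and `T` factors through their meet. -/
theorem exists_factor_meet [HasBinaryProducts C] {A B : C} {R S T : MySpan C A B}
    (hS : ∃ m : R.apex ⟶ S.apex, m ≫ S.left = R.left ∧ m ≫ S.right = R.right)
    (hT : ∃ m : R.apex ⟶ T.apex, m ≫ T.left = R.left ∧ m ≫ T.right = R.right) :
    ∃ m : R.apex ⟶ (S.meet T).apex,
      m ≫ (S.meet T).left = R.left ∧ m ≫ (S.meet T).right = R.right := by
  obtain ⟨a, hal, har⟩ := hS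
  obtain ⟨b, hbl, hbr⟩ := hT
  refine ⟨pullback.lift a b (by simp only [prod.comp_lift, hal, har, hbl, hbr]),
    (pullback.lift_fst_assoc _ _ _ _).trans hal, (pullback.lift_fst_assoc _ _ _ _).trans har⟩

/-- Composition with a fixed span preserves factorization of spans. -/
theorem exists_factor_comp {A B X : C} {R S : MySpan C A B} (T : MySpan C B X)
    (m : R.apex ⟶ S.apex) (hl : m ≫ S.left = R.left) (hr : m ≫ S.right = R.right) :
    ∃ n : (R.comp T).apex ⟶ (S.comp T).apex,
      n ≫ (S.comp T).left = (R.comp T).left ∧ n ≫ (S.comp T).right = (R.comp T).right := by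
  have h : (pullback.fst R.right T.left ≫ m) ≫ S.right =
      pullback.snd R.right T.left ≫ T.left := by
    rw [Category.assoc, hr, pullback.condition]
  refine ⟨pullback.lift _ _ h, (pullback.lift_fst_assoc _ _ h _).trans ?_,
    pullback.lift_snd_assoc _ _ h _⟩
  rw [Category.assoc, hl]
  rfl

/-- The second projection of a meet is a morphism of spans. -/
theorem meet_snd_left [HasBinaryProducts C] {A B : C} (S T : MySpan C A B) :
    pullback.snd (prod.lift S.left S.right) (prod.lift T.left T.right) ≫ T.left =
      (S.meet T).left := by
  simpa [meet, prod.lift_fst, -prod.comp_lift] using (congrArg (· ≫ prod.fst) (pullback.condition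
    (f := prod.lift S.left S.right) (g := prod.lift T.left T.right))).symm

/-- The second projection of a meet is a morphism of spans. -/
theorem meet_snd_right [HasBinaryProducts C] {A B : C} (S T : MySpan C A B) :
    pullback.snd (prod.lift S.left S.right) (prod.lift T.left T.right) ≫ T.right =
      (S.meet T).right := by
  simpa [meet, prod.lift_snd, -prod.comp_lift] using (congrArg (· ≫ prod.snd) (pullback.condition
    (f := prod.lift S.left S.right) (g := prod.lift T.left T.right))).symm

end MySpan

/-- Lax distributivity up to a compatible allegorical equivalence: for spans
`S, S' : A ⇸ B` and `T : B ⇸ X` one has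
`((T∘(S∧S')) ∧ ((T∘S)∧(T∘S'))) ∼ T∘(S∧S')`, all composites and meets being computed via
the chosen pullbacks and products. -/
theorem lax_distributivity_up_to_sim [HasPullbacks C] [HasBinaryProducts C]
    (r : ∀ ⦃A B : C⦄, MySpan C A B → MySpan C A B → Prop)
    (hequiv : ∀ A B : C, Equivalence (fun S T : MySpan C A B => r S T))
    (hiso : RelatesVertIso r) (hinv : InvCompatible r) (hcomp : CompCompatible r)
    (hmeet : MeetCompatible r) (hall : RelAllegorical r)
    {A B X : C} (S S' : MySpan C A B) (T : MySpan C B X) :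
    r (((S.meet S').comp T).meet ((S.comp T).meet (S'.comp T)))
      ((S.meet S').comp T) := by
  obtain ⟨m, hl, hr⟩ := MySpan.exists_factor_meet
    (MySpan.exists_factor_comp (R := S.meet S') (S := S) T (pullback.fst _ _) rfl rfl)
    (MySpan.exists_factor_comp (R := S.meet S') (S := S') T (pullback.snd _ _)
      (MySpan.meet_snd_left S S') (MySpan.meet_snd_right S S'))
  exact rel_meet_of_factors hequiv hiso hinv hcomp hall _ _ m hl hr
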